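/- arXiv:1705.03637 — 2 statements merged into one kernel-verified Lean document; each statement's English description precedes it below -/
import Mathlib

section
/- Let T be a DFS tree of a finite connected simple graph G rooted at r. Let r_c and v_H be vertices, let v_l be their lowest common ancestor in T, let Q be the vertex set of the tree path from r_c to v_H (i.e., path(r_c, v_l) ∪ path(v_l, v_H)), and let p be the set of strict ancestors of v_l. Then the connected components of the induced subgraph of G on V \ Q are exactly: (i) for each subtree T(w) hanging from Q such that G has no edge between T(w) and p, the set T(w) by itself; and (ii) if p is nonempty, one further component consisting of p, all subtrees of T hanging from p, and all subtrees T(w) hanging from Q that have a G-edge to p. In particular, if v_l = r (so p is empty), every component is a single subtree hanging from Q. -/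
/-- `u` is an ancestor of `v` in the tree `T` rooted at `r`:
`u` lies on the (unique) path in `T` from `r` to `v`. -/
def IsAncestor {V : Type*} (T : SimpleGraph V) (r u v : V) : Prop :=
  ∀ p : T.Walk r v, p.IsPath → u ∈ p.support

/-- `T(v)`: the set of descendants of `v` in the tree `T` rooted at `r`. -/
def descendants {V : Type*} (T : SimpleGraph V) (r v : V) : Set V :=
  {w | IsAncestor T r v w}

/-- `T` is a DFS tree of `G` rooted at `r`: a spanning tree of `G` such that every edge of `G`
joins two vertices one of which is an ancestor of the other in `T`. -/
def IsDFSTree {V : Type*} (G T : SimpleGraph V) (r : V) : Prop :=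
  T ≤ G ∧ T.IsTree ∧
    ∀ u v : V, G.Adj u v → IsAncestor T r u v ∨ IsAncestor T r v u

/-- `S` is a connected component of the subgraph of `G` induced on the vertex set `A`. -/
def IsComponentOf {V : Type*} (G : SimpleGraph V) (A S : Set V) : Prop :=
  S ⊆ A ∧ S.Nonempty ∧ (SimpleGraph.induce S G).Connected ∧
    ∀ a ∈ S, ∀ b ∈ A, b ∉ S → ¬ G.Adj a b

/-- The subtree `T(w)` hangs from the vertex set `P`: `w ∉ P` and the parent of `w`
(the neighbor of `w` in `T` that is an ancestor of `w`) lies in `P`. -/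
def HangsFrom {V : Type*} (T : SimpleGraph V) (r : V) (P : Set V) (w : V) : Prop :=
  w ∉ P ∧ ∃ u ∈ P, T.Adj u w ∧ IsAncestor T r u w

/-- `l` is the lowest common ancestor of `u` and `v` in the tree `T` rooted at `r`. -/
def IsLCA {V : Type*} (T : SimpleGraph V) (r u v l : V) : Prop :=
  IsAncestor T r l u ∧ IsAncestor T r l v ∧
    ∀ z, IsAncestor T r z u → IsAncestor T r z v → IsAncestor T r z l

/-- `path(x,y)` for `x` an ancestor of `y`: the set of vertices `z` such that `x` is an
ancestor of `z` and `z` is an ancestor of `y`. -/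
def tpath {V : Type*} (T : SimpleGraph V) (r x y : V) : Set V :=
  {z | IsAncestor T r x z ∧ IsAncestor T r z y}

section Ancestor

variable {V : Type*} {T : SimpleGraph V} {r u v w z : V}

theorem isAncestor_iff_mem_support (hT : T.IsTree) {q : T.Walk r v} (hq : q.IsPath) :
    IsAncestor T r u v ↔ u ∈ q.support := by
  refine ⟨fun h => h q hq, fun h q' hq' => ?_⟩
  rwa [← (hT.existsUnique_path r v).unique hq hq']

theorem exists_isPath (hT : T.IsTree) (r v : V) : ∃ q : T.Walk r v, q.IsPath :=
  (hT.existsUnique_path r v).exists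

theorem IsAncestor.refl (T : SimpleGraph V) (r v : V) : IsAncestor T r v v :=
  fun q _ => q.end_mem_support

theorem IsAncestor.root (T : SimpleGraph V) (r v : V) : IsAncestor T r r v :=
  fun q _ => q.start_mem_support

theorem IsAncestor.trans (huv : IsAncestor T r u v) (hvw : IsAncestor T r v w) :
    IsAncestor T r u w := by
  classical
  intro q hq
  have hv := hvw q hq
  exact q.support_takeUntil_subset_support hv (huv _ (hq.takeUntil hv))

theorem IsAncestor.antisymm (hT : T.IsTree) (huv : IsAncestor T r u v)
    (hvu : IsAncestor T r v u) : u = v := by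
  classical
  by_contra hne
  obtain ⟨q, hq⟩ := exists_isPath hT r v
  have hu := huv q hq
  exact SimpleGraph.Walk.endpoint_notMem_support_takeUntil hq hu (Ne.symm hne)
    (hvu _ (hq.takeUntil hu))

theorem isAncestor_iff_of_adj (hT : T.IsTree) (hadj : T.Adj u w) (huw : IsAncestor T r u w) :
    IsAncestor T r z w ↔ IsAncestor T r z u ∨ z = w := by
  obtain ⟨q, hq⟩ := exists_isPath hT r u
  have hw : w ∉ q.support := fun h =>
    hadj.ne (huw.antisymm hT ((isAncestor_iff_mem_support hT hq).2 h))
  rw [isAncestor_iff_mem_support hT hq, isAncestor_iff_mem_support hT (hq.concat hw hadj)]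
  simp [SimpleGraph.Walk.support_concat]

/-- Induction along the rooted tree, from parents to children. -/
theorem rootedTree_induction (hT : T.IsTree) {motive : V → Prop} (root : motive r)
    (step : ∀ u v, T.Adj u v → IsAncestor T r u v → motive u → motive v) (v : V) : motive v := by
  obtain ⟨q, hq⟩ := exists_isPath hT r v
  induction hn : q.length generalizing v with
  | zero => exact SimpleGraph.Walk.eq_of_length_eq_zero hn ▸ root
  | succ n ih =>
    have hnil : ¬ q.Nil := by
      rw [← SimpleGraph.Walk.length_eq_zero_iff]
      omega
    refine step q.penultimate v (q.adj_penultimate hnil)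
      ((isAncestor_iff_mem_support hT hq).2 (q.getVert_mem_support _))
      (ih _ q.dropLast (hq.take _) ?_)
    have := q.length_dropLast_add_one hnil
    omega

theorem IsAncestor.total (hT : T.IsTree) (hu : IsAncestor T r u w) (hv : IsAncestor T r v w) :
    IsAncestor T r u v ∨ IsAncestor T r v u := by
  induction w using rootedTree_induction hT (r := r) with
  | root =>
    exact .inl (hu.antisymm hT (.root T r u) ▸ .root T r v)
  | step x y hadj hxy ih =>
    rcases (isAncestor_iff_of_adj hT hadj hxy).1 hu with hu' | rfl
    · rcases (isAncestor_iff_of_adj hT hadj hxy).1 hv with hv' | rfl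
      · exact ih hu' hv'
      · exact .inl hu
    · exact .inr hv

end Ancestor

section ReachableIn

variable {V : Type*} {G : SimpleGraph V} {S S' A : Set V} {x y z : V}

/-- `x` and `y` are joined by a walk of `G` that stays inside `S`. -/
def ReachableIn (G : SimpleGraph V) (S : Set V) (x y : V) : Prop :=
  ∃ (hx : x ∈ S) (hy : y ∈ S), (SimpleGraph.induce S G).Reachable ⟨x, hx⟩ ⟨y, hy⟩

theorem ReachableIn.refl (hx : x ∈ S) : ReachableIn G S x x := ⟨hx, hx, .rfl⟩

theorem ReachableIn.symm (h : ReachableIn G S x y) : ReachableIn G S y x := by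
  obtain ⟨hx, hy, h⟩ := h
  exact ⟨hy, hx, h.symm⟩

theorem ReachableIn.trans (h : ReachableIn G S x y) (h' : ReachableIn G S y z) :
    ReachableIn G S x z := by
  obtain ⟨hx, _, h⟩ := h
  obtain ⟨_, hz, h'⟩ := h'
  exact ⟨hx, hz, h.trans h'⟩

theorem ReachableIn.of_adj (hx : x ∈ S) (hy : y ∈ S) (h : G.Adj x y) : ReachableIn G S x y :=
  ⟨hx, hy, SimpleGraph.Adj.reachable (by simpa using h)⟩

theorem connected_induce_of_reachableIn (hx : x ∈ S) (h : ∀ y ∈ S, ReachableIn G S x y) :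
    (SimpleGraph.induce S G).Connected := by
  refine { preconnected := ?_, nonempty := ⟨⟨x, hx⟩⟩ }
  rintro ⟨y, hy⟩ ⟨z, hz⟩
  exact ((h y hy).symm.trans (h z hz)).2.2

theorem subset_of_connected_of_closed (hSA : S ⊆ A) (hS : (SimpleGraph.induce S G).Connected)
    (hS' : ∀ a ∈ S', ∀ b ∈ A, b ∉ S' → ¬ G.Adj a b) (hx : x ∈ S) (hx' : x ∈ S') : S ⊆ S' := by
  intro y hy
  obtain ⟨q⟩ := hS.preconnected ⟨x, hx⟩ ⟨y, hy⟩
  suffices ∀ (a b : S), (SimpleGraph.induce S G).Walk a b → (a : V) ∈ S' → (b : V) ∈ S' from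
    this _ _ q hx'
  intro a b q ha
  induction q with
  | nil => exact ha
  | @cons a c _ hadj _ ih =>
    refine ih (by_contra fun hc => hS' a ha c (hSA c.2) hc ?_)
    simpa using hadj

theorem IsComponentOf.eq_of_mem (hS : IsComponentOf G A S) (hS' : IsComponentOf G A S')
    (hx : x ∈ S) (hx' : x ∈ S') : S = S' :=
  (subset_of_connected_of_closed hS.1 hS.2.2.1 hS'.2.2.2 hx hx').antisymm
    (subset_of_connected_of_closed hS'.1 hS'.2.2.1 hS.2.2.2 hx' hx)

theorem reachableIn_of_isAncestor {T : SimpleGraph V} {r w v : V} (hT : T.IsTree) (hTG : T ≤ G)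
    (hwv : IsAncestor T r w v) (h : ∀ z, IsAncestor T r w z → IsAncestor T r z v → z ∈ S) :
    ReachableIn G S w v := by
  induction v using rootedTree_induction hT (r := r) with
  | root =>
    obtain rfl := hwv.antisymm hT (.root T r w)
    exact .refl (h _ hwv hwv)
  | step x y hadj hxy ih =>
    rcases (isAncestor_iff_of_adj hT hadj hxy).1 hwv with hwx | rfl
    · exact (ih hwx fun z hz hzx => h z hz (hzx.trans hxy)).trans
        (.of_adj (h x hwx hxy) (h y hwv (.refl T r y)) (hTG hadj))
    · exact .refl (h _ hwv (.refl T r _))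

end ReachableIn

section HangingSubtrees

variable {V : Type*} {G T : SimpleGraph V} {r l : V} {Q : Set V}

/-- `Q` is a subtree of the rooted tree `T` whose topmost vertex is `l`. -/
structure IsSubtreeWithTop (T : SimpleGraph V) (r l : V) (Q : Set V) : Prop where
  top_mem : l ∈ Q
  top_isAncestor : ∀ x ∈ Q, IsAncestor T r l x
  mem_of_isAncestor : ∀ z, ∀ x ∈ Q, IsAncestor T r l z → IsAncestor T r z x → z ∈ Q

theorem isSubtreeWithTop_tpath_union {a b : V} (ha : IsAncestor T r l a) :
    IsSubtreeWithTop T r l (tpath T r l a ∪ tpath T r l b) where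
  top_mem := .inl ⟨.refl T r l, ha⟩
  top_isAncestor := by
    rintro x (hx | hx)
    exacts [hx.1, hx.1]
  mem_of_isAncestor := by
    rintro z x (hx | hx) hlz hzx
    exacts [.inl ⟨hlz, hzx.trans hx.2⟩, .inr ⟨hlz, hzx.trans hx.2⟩]

/-- The strict ancestors of `l`. -/
def strictAncestors (T : SimpleGraph V) (r l : V) : Set V :=
  {z | IsAncestor T r z l ∧ z ≠ l}

/-- The vertices joined to the strict ancestors of `l` after deleting `Q`: the strict ancestors
of `l`, the subtrees hanging from them other than `T(l)`, and the subtrees hanging from `Q` that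
have a `G`-edge to them. -/
def upperPart (G T : SimpleGraph V) (r l : V) (Q : Set V) : Set V :=
  strictAncestors T r l
    ∪ (⋃ w ∈ {w | w ≠ l ∧ HangsFrom T r (strictAncestors T r l) w}, descendants T r w)
    ∪ (⋃ w ∈ {w | HangsFrom T r Q w ∧
          ∃ a ∈ descendants T r w, ∃ b ∈ strictAncestors T r l, G.Adj a b},
        descendants T r w)

theorem mem_upperPart {x : V} : x ∈ upperPart G T r l Q ↔
    x ∈ strictAncestors T r l ∨
    (∃ w, w ≠ l ∧ HangsFrom T r (strictAncestors T r l) w ∧ IsAncestor T r w x) ∨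
    ∃ w, HangsFrom T r Q w ∧
      (∃ a, IsAncestor T r w a ∧ ∃ b ∈ strictAncestors T r l, G.Adj a b) ∧
      IsAncestor T r w x := by
  simp only [upperPart, descendants, Set.mem_union, Set.mem_iUnion, Set.mem_ofPred_eq, exists_prop,
    or_assoc, and_assoc]

theorem HangsFrom.top_isAncestor (hQ : IsSubtreeWithTop T r l Q) {w : V}
    (hw : HangsFrom T r Q w) : IsAncestor T r l w := by
  obtain ⟨-, u, hu, -, huw⟩ := hw
  exact (hQ.top_isAncestor u hu).trans huw

theorem HangsFrom.notMem_of_isAncestor (hQ : IsSubtreeWithTop T r l Q) {w x : V}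
    (hw : HangsFrom T r Q w) (hwx : IsAncestor T r w x) : x ∉ Q := fun hx =>
  hw.1 (hQ.mem_of_isAncestor w x hx (hw.top_isAncestor hQ) hwx)

theorem HangsFrom.eq_of_isAncestor (hT : T.IsTree) (hQ : IsSubtreeWithTop T r l Q) {w w' : V}
    (hw : HangsFrom T r Q w) (hw' : HangsFrom T r Q w') (h : IsAncestor T r w w') : w = w' := by
  obtain ⟨-, u, hu, hadj, huw'⟩ := hw'
  refine ((isAncestor_iff_of_adj hT hadj huw').1 h).resolve_left fun hwu => ?_
  exact hw.notMem_of_isAncestor hQ hwu hu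

theorem not_isAncestor_of_mem_strictAncestors (hT : T.IsTree) {x : V}
    (hx : x ∈ strictAncestors T r l) : ¬ IsAncestor T r l x := fun h =>
  hx.2 (hx.1.antisymm hT h)

theorem HangsFrom.not_isAncestor_of_strictAncestors (hT : T.IsTree) {w x : V} (hwl : w ≠ l)
    (hw : HangsFrom T r (strictAncestors T r l) w) (hwx : IsAncestor T r w x) :
    ¬ IsAncestor T r l x := by
  intro hlx
  rcases hwx.total hT hlx with h | h
  · exact hw.1 ⟨h, hwl⟩
  · obtain ⟨-, u, hu, hadj, huw⟩ := hw
    rcases (isAncestor_iff_of_adj hT hadj huw).1 h with h | h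
    · exact not_isAncestor_of_mem_strictAncestors hT hu h
    · exact hwl h.symm

theorem mem_strictAncestors_or_hangs (hT : T.IsTree) (hQ : IsSubtreeWithTop T r l Q) (x : V)
    (hx : x ∉ Q) :
    x ∈ strictAncestors T r l ∨
    (∃ w, w ≠ l ∧ HangsFrom T r (strictAncestors T r l) w ∧ IsAncestor T r w x) ∨
    ∃ w, HangsFrom T r Q w ∧ IsAncestor T r w x := by
  induction x using rootedTree_induction hT (r := r) with
  | root => exact .inl ⟨.root T r l, fun h => hx (h ▸ hQ.top_mem)⟩
  | step u v hadj huv ih =>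
    by_cases hu : u ∈ Q
    · exact .inr (.inr ⟨v, ⟨hx, u, hu, hadj, huv⟩, .refl T r v⟩)
    rcases ih hu with hp | ⟨w, hwl, hw, hwu⟩ | ⟨w, hw, hwu⟩
    · by_cases hv : v ∈ strictAncestors T r l
      · exact .inl hv
      · exact .inr (.inl ⟨v, fun h => hx (h ▸ hQ.top_mem), ⟨hv, u, hp, hadj, huv⟩,
          .refl T r v⟩)
    · exact .inr (.inl ⟨w, hwl, hw, hwu.trans huv⟩)
    · exact .inr (.inr ⟨w, hw, hwu.trans huv⟩)

/-- An edge of `G` leaving a subtree hanging from `Q` ends in `Q` or above `Q`. -/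
theorem HangsFrom.mem_strictAncestors_of_adj (hDFS : IsDFSTree G T r)
    (hQ : IsSubtreeWithTop T r l Q) {w a b : V} (hw : HangsFrom T r Q w)
    (ha : IsAncestor T r w a) (hbQ : b ∉ Q) (hb : ¬ IsAncestor T r w b) (hab : G.Adj a b) :
    b ∈ strictAncestors T r l := by
  have hT := hDFS.2.1
  obtain ⟨-, u, hu, hadj, huw⟩ := hw
  rcases hDFS.2.2 a b hab with h | h
  · exact absurd (ha.trans h) hb
  have hbw := (h.total hT ha).resolve_right hb
  have hbu : IsAncestor T r b u := by
    refine ((isAncestor_iff_of_adj hT hadj huw).1 hbw).resolve_right ?_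
    rintro rfl
    exact hb (.refl T r b)
  rcases hbu.total hT (hQ.top_isAncestor u hu) with h | h
  · exact ⟨h, fun h => hbQ (h ▸ hQ.top_mem)⟩
  · exact absurd (hQ.mem_of_isAncestor b u hu h hbu) hbQ

theorem isComponentOf_descendants (hDFS : IsDFSTree G T r) (hQ : IsSubtreeWithTop T r l Q) {w : V}
    (hw : HangsFrom T r Q w)
    (hno : ∀ a ∈ descendants T r w, ∀ b ∈ strictAncestors T r l, ¬ G.Adj a b) :
    IsComponentOf G Qᶜ (descendants T r w) := by
  have hT := hDFS.2.1
  refine ⟨fun x hx => hw.notMem_of_isAncestor hQ hx, ⟨w, .refl T r w⟩, ?_, ?_⟩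
  · exact connected_induce_of_reachableIn (x := w) (.refl T r w) fun y hy =>
      reachableIn_of_isAncestor hT hDFS.1 hy fun _ hz _ => hz
  · exact fun a ha b hbQ hb hab =>
      hno a ha b (hw.mem_strictAncestors_of_adj hDFS hQ ha hbQ hb hab) hab

theorem upperPart_subset_compl (hT : T.IsTree) (hQ : IsSubtreeWithTop T r l Q) :
    upperPart G T r l Q ⊆ Qᶜ := by
  intro x hx hxQ
  have hlx := hQ.top_isAncestor x hxQ
  rcases mem_upperPart.1 hx with hx | ⟨w, hwl, hw, hwx⟩ | ⟨w, hw, -, hwx⟩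
  · exact not_isAncestor_of_mem_strictAncestors hT hx hlx
  · exact hw.not_isAncestor_of_strictAncestors hT hwl hwx hlx
  · exact hw.notMem_of_isAncestor hQ hwx hxQ

theorem connected_upperPart (hT : T.IsTree) (hTG : T ≤ G)
    (hp : (strictAncestors T r l).Nonempty) :
    (SimpleGraph.induce (upperPart G T r l Q) G).Connected := by
  have hanc : ∀ x ∈ strictAncestors T r l, ∀ z, IsAncestor T r z x →
      z ∈ strictAncestors T r l := fun x hx z hzx =>
    ⟨hzx.trans hx.1, fun h => not_isAncestor_of_mem_strictAncestors hT hx (h ▸ hzx)⟩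
  have hreach : ∀ x ∈ strictAncestors T r l, ReachableIn G (upperPart G T r l Q) r x :=
    fun x hx => reachableIn_of_isAncestor hT hTG (.root T r x) fun z _ hzx =>
      mem_upperPart.2 (.inl (hanc x hx z hzx))
  obtain ⟨x₀, hx₀⟩ := hp
  refine connected_induce_of_reachableIn (x := r)
    (mem_upperPart.2 (.inl (hanc x₀ hx₀ r (.root T r x₀)))) fun y hy => ?_
  rcases mem_upperPart.1 hy with hy | ⟨w, hwl, hw, hwy⟩ | ⟨w, hw, ⟨a, hwa, b, hb, hab⟩, hwy⟩
  · exact hreach y hy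
  · have hsub : ∀ z, IsAncestor T r w z → z ∈ upperPart G T r l Q := fun z hz =>
      mem_upperPart.2 (.inr (.inl ⟨w, hwl, hw, hz⟩))
    obtain ⟨-, u, hu, hadj, -⟩ := hw
    exact ((hreach u hu).trans (.of_adj (mem_upperPart.2 (.inl hu)) (hsub w (.refl T r w))
      (hTG hadj))).trans (reachableIn_of_isAncestor hT hTG hwy fun z hz _ => hsub z hz)
  · have hsub : ∀ z, IsAncestor T r w z → z ∈ upperPart G T r l Q := fun z hz =>
      mem_upperPart.2 (.inr (.inr ⟨w, hw, ⟨a, hwa, b, hb, hab⟩, hz⟩))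
    have hw_reach : ∀ z, IsAncestor T r w z → ReachableIn G (upperPart G T r l Q) w z :=
      fun z hz => reachableIn_of_isAncestor hT hTG hz fun z hz _ => hsub z hz
    exact (((hreach b hb).trans (.of_adj (mem_upperPart.2 (.inl hb)) (hsub a hwa)
      hab.symm)).trans (hw_reach a hwa).symm).trans (hw_reach y hwy)

theorem isComponentOf_upperPart (hDFS : IsDFSTree G T r) (hQ : IsSubtreeWithTop T r l Q)
    (hp : (strictAncestors T r l).Nonempty) : IsComponentOf G Qᶜ (upperPart G T r l Q) := by
  have hT := hDFS.2.1
  refine ⟨upperPart_subset_compl hT hQ, hp.mono fun x hx => mem_upperPart.2 (.inl hx),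
    connected_upperPart hT hDFS.1 hp, fun a ha b hbQ hb hab => ?_⟩
  rcases mem_strictAncestors_or_hangs hT hQ b hbQ with h | h | ⟨w, hw, hwb⟩
  · exact hb (mem_upperPart.2 (.inl h))
  · exact hb (mem_upperPart.2 (.inr (.inl h)))
  have hno : ∀ c, IsAncestor T r w c → ∀ d ∈ strictAncestors T r l, ¬ G.Adj c d :=
    fun c hc d hd hcd => hb (mem_upperPart.2 (.inr (.inr ⟨w, hw, ⟨c, hc, d, hd, hcd⟩, hwb⟩)))
  have hwa : IsAncestor T r w a := by
    by_contra hwa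
    exact hno b hwb a (hw.mem_strictAncestors_of_adj hDFS hQ hwb
      (upperPart_subset_compl hT hQ ha) hwa hab.symm) hab.symm
  have hla := (hw.top_isAncestor hQ).trans hwa
  rcases mem_upperPart.1 ha with ha | ⟨w', hwl', hw', hwa'⟩ | ⟨w', hw', ⟨c, hc, d, hd, hcd⟩, hwa'⟩
  · exact not_isAncestor_of_mem_strictAncestors hT ha hla
  · exact hw'.not_isAncestor_of_strictAncestors hT hwl' hwa' hla
  · obtain rfl : w = w' := (hwa.total hT hwa').elim (hw.eq_of_isAncestor hT hQ hw')
      fun h => (hw'.eq_of_isAncestor hT hQ hw h).symm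
    exact hno c hc d hd hcd

theorem isComponentOf_compl_iff (hDFS : IsDFSTree G T r) (hQ : IsSubtreeWithTop T r l Q)
    (S : Set V) : IsComponentOf G Qᶜ S ↔
      (∃ w, HangsFrom T r Q w ∧
        (∀ a ∈ descendants T r w, ∀ b ∈ strictAncestors T r l, ¬ G.Adj a b) ∧
        S = descendants T r w) ∨
      ((strictAncestors T r l).Nonempty ∧ S = upperPart G T r l Q) := by
  have hT := hDFS.2.1
  constructor
  · intro hS
    obtain ⟨x, hx⟩ := hS.2.1
    have hupper (h : x ∈ upperPart G T r l Q) (hp : (strictAncestors T r l).Nonempty) :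
        S = upperPart G T r l Q :=
      hS.eq_of_mem (isComponentOf_upperPart hDFS hQ hp) hx h
    rcases mem_strictAncestors_or_hangs hT hQ x (hS.1 hx) with h | h | ⟨w, hw, hwx⟩
    · have hp : (strictAncestors T r l).Nonempty := ⟨x, h⟩
      exact .inr ⟨hp, hupper (mem_upperPart.2 (.inl h)) hp⟩
    · have hp : (strictAncestors T r l).Nonempty := by
        obtain ⟨w, -, ⟨-, u, hu, -⟩, -⟩ := h
        exact ⟨u, hu⟩
      exact .inr ⟨hp, hupper (mem_upperPart.2 (.inr (.inl h))) hp⟩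
    · by_cases hno : ∀ a ∈ descendants T r w, ∀ b ∈ strictAncestors T r l, ¬ G.Adj a b
      · exact .inl ⟨w, hw, hno,
          hS.eq_of_mem (isComponentOf_descendants hDFS hQ hw hno) hx hwx⟩
      · push Not at hno
        obtain ⟨a, ha, b, hb, hab⟩ := hno
        have hp : (strictAncestors T r l).Nonempty := ⟨b, hb⟩
        exact .inr ⟨hp, hupper
          (mem_upperPart.2 (.inr (.inr ⟨w, hw, ⟨a, ha, b, hb, hab⟩, hwx⟩))) hp⟩
  · rintro (⟨w, hw, hno, rfl⟩ | ⟨hp, rfl⟩)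
    · exact isComponentOf_descendants hDFS hQ hw hno
    · exact isComponentOf_upperPart hDFS hQ hp

end HangingSubtrees

/-- Let `T` be a DFS tree of a finite connected graph `G` rooted at `r`, let `v_l` be the LCA
of `r_c` and `v_H`, let `Q = path(v_l, r_c) ∪ path(v_l, v_H)` be the tree path from `r_c` to
`v_H`, and let `p` be the set of strict ancestors of `v_l`. Then the connected components of
the subgraph of `G` induced on `V \ Q` are exactly: (i) for each subtree `T(w)` hanging from
`Q` with no `G`-edge between `T(w)` and `p`, the set `T(w)`; and (ii) if `p` is nonempty, one
further component consisting of `p`, all subtrees of `T` hanging from `p` (other than the one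
rooted at `v_l`), and all subtrees `T(w)` hanging from `Q` having a `G`-edge to `p`. -/
theorem components_along_lca_path {V : Type*} [Fintype V] (G T : SimpleGraph V) (r : V)
    (hG : G.Connected) (hDFS : IsDFSTree G T r)
    (rc vH vl : V) (hlca : IsLCA T r rc vH vl)
    (Q p : Set V)
    (hQ : Q = tpath T r vl rc ∪ tpath T r vl vH)
    (hp : p = {z | IsAncestor T r z vl ∧ z ≠ vl}) :
    ∀ S : Set V, IsComponentOf G Qᶜ S ↔
      ((∃ w, HangsFrom T r Q w ∧
          (∀ a ∈ descendants T r w, ∀ b ∈ p, ¬ G.Adj a b) ∧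
          S = descendants T r w) ∨
       (p.Nonempty ∧
        S = p ∪ (⋃ w ∈ {w | w ≠ vl ∧ HangsFrom T r p w}, descendants T r w)
              ∪ (⋃ w ∈ {w | HangsFrom T r Q w ∧
                    ∃ a ∈ descendants T r w, ∃ b ∈ p, G.Adj a b},
                  descendants T r w))) := by
  subst hQ hp
  exact isComponentOf_compl_iff hDFS (isSubtreeWithTop_tpath_union hlca.1)
end

section
/- Let T be a DFS tree of a finite simple graph G rooted at r. Let p' be the vertex set of an ancestor–descendant path in T and let v_1, …, v_k be pairwise incomparable vertices (for i ≠ j, neither v_i nor v_j is an ancestor of the other) such that each T(v_i) is disjoint from p'. Set S = p' ∪ T(v_1) ∪ … ∪ T(v_k). Then the connected components of the induced subgraph of G on S are exactly: for each i such that G has no edge between T(v_i) and p', the set T(v_i); and one component consisting of p' together with all the T(v_i) that have a G-edge to p'. (This is the invariant that every component of the unvisited graph is of type C1—a single subtree—or type C2—an ancestor–descendant path together with the subtrees having an edge to it.) -/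
namespace IsAncestor

variable {V : Type*} {T : SimpleGraph V} {r u v w z : V}

theorem of_mem_support (hT : T.IsTree) {p : T.Walk r v} (hp : p.IsPath) (h : u ∈ p.support) :
    IsAncestor T r u v := fun q hq => by
  rwa [(hT.existsUnique_path r v).unique hq hp]

theorem refl_s6 (T : SimpleGraph V) (r v : V) : IsAncestor T r v v := fun p _ => p.end_mem_support

theorem trans_s6 (huv : IsAncestor T r u v) (hvw : IsAncestor T r v w) :
    IsAncestor T r u w := fun p hp => by
  classical
  exact p.support_takeUntil_subset_support (hvw p hp) (huv _ (hp.takeUntil _))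

theorem of_mem_support_dropUntil [DecidableEq V] (hT : T.IsTree) {p : T.Walk r w}
    (hp : p.IsPath) (hv : v ∈ p.support) (hu : u ∈ (p.dropUntil v hv).support) :
    IsAncestor T r v u := by
  have h : ((p.takeUntil v hv).append ((p.dropUntil v hv).takeUntil u hu)).IsPath := by
    refine SimpleGraph.Walk.IsPath.of_append_left (q := (p.dropUntil v hv).dropUntil u hu) ?_
    rwa [← SimpleGraph.Walk.append_assoc, SimpleGraph.Walk.take_spec,
      SimpleGraph.Walk.take_spec]
  exact of_mem_support hT h <| by simp

/-- Two ancestors of a common vertex are comparable. -/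
theorem total_s6 (hT : T.IsTree) (hu : IsAncestor T r u w) (hv : IsAncestor T r v w) :
    IsAncestor T r u v ∨ IsAncestor T r v u := by
  classical
  obtain ⟨p, hp, -⟩ := hT.existsUnique_path r w
  have hvp := hv p hp
  have hup := hu p hp
  rw [← p.take_spec hvp, SimpleGraph.Walk.mem_support_append_iff] at hup
  exact hup.imp (of_mem_support hT (hp.takeUntil hvp)) (of_mem_support_dropUntil hT hp hvp)

end IsAncestor

section

variable {V : Type*} {G T : SimpleGraph V} {r : V}

/-- A vertex set with a topmost vertex that is closed under taking tree paths below that vertex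
induces a connected subgraph. -/
theorem connected_induce_of_tpath_subset (hT : T.IsTree) (hTG : T ≤ G) {s : Set V} {v : V}
    (hv : v ∈ s) (hanc : ∀ w ∈ s, IsAncestor T r v w) (hs : ∀ w ∈ s, tpath T r v w ⊆ s) :
    (G.induce s).Connected := by
  classical
  rw [SimpleGraph.connected_iff_exists_forall_reachable]
  refine ⟨⟨v, hv⟩, fun ⟨w, hw⟩ => ?_⟩
  obtain ⟨p, hp, -⟩ := hT.existsUnique_path r w
  have hvp := hanc w hw p hp
  have hsub : ∀ z ∈ (p.dropUntil v hvp).support, z ∈ s := fun z hz =>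
    hs w hw ⟨IsAncestor.of_mem_support_dropUntil hT hp hvp hz,
      IsAncestor.of_mem_support hT hp (p.support_dropUntil_subset_support hvp hz)⟩
  have hreach : (T.induce s).Reachable ⟨v, hv⟩ ⟨w, hw⟩ := ⟨(p.dropUntil v hvp).induce s hsub⟩
  exact hreach.mono (SimpleGraph.comap_monotone _ hTG)

theorem connected_induce_descendants (hT : T.IsTree) (hTG : T ≤ G) (v : V) :
    (G.induce (descendants T r v)).Connected :=
  connected_induce_of_tpath_subset hT hTG (IsAncestor.refl_s6 T r v) (fun _ h => h)
    fun _ _ _ hz => hz.1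

theorem connected_induce_tpath (hT : T.IsTree) (hTG : T ≤ G) {x y : V}
    (hxy : IsAncestor T r x y) : (G.induce (tpath T r x y)).Connected :=
  connected_induce_of_tpath_subset hT hTG ⟨IsAncestor.refl_s6 T r x, hxy⟩ (fun _ h => h.1)
    fun _ hw _ hz => ⟨hz.1, hz.2.trans_s6 hw.2⟩

theorem IsDFSTree.not_adj_descendants (h : IsDFSTree G T r) {u v a b : V}
    (huv : ¬ IsAncestor T r u v) (hvu : ¬ IsAncestor T r v u)
    (ha : a ∈ descendants T r u) (hb : b ∈ descendants T r v) : ¬ G.Adj a b := fun hab => by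
  have key : IsAncestor T r u v ∨ IsAncestor T r v u := by
    rcases h.2.2 a b hab with hc | hc
    · exact IsAncestor.total_s6 h.2.1 (IsAncestor.trans_s6 ha hc) hb
    · exact IsAncestor.total_s6 h.2.1 ha (IsAncestor.trans_s6 hb hc)
  exact key.elim huv hvu

theorem IsComponentOf.subset_of_mem {A C D : Set V} (hC : IsComponentOf G A C)
    (hD : IsComponentOf G A D) {c : V} (hcC : c ∈ C) (hcD : c ∈ D) : C ⊆ D := by
  intro z hz
  obtain ⟨p⟩ := hC.2.2.1.preconnected ⟨c, hcC⟩ ⟨z, hz⟩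
  have key : ∀ {a b : C}, (G.induce C).Walk a b → (a : V) ∈ D → (b : V) ∈ D := by
    intro a b p
    induction p with
    | nil => exact id
    | @cons a b _ hab _ ih =>
      refine fun ha => ih (by_contra fun hb => ?_)
      exact hD.2.2.2 a ha b (hC.1 b.2) hb hab
  exact key p hcD

/-- Components sharing a vertex are equal. -/
theorem IsComponentOf.eq_of_mem_s6 {A C D : Set V} (hC : IsComponentOf G A C)
    (hD : IsComponentOf G A D) {c : V} (hcC : c ∈ C) (hcD : c ∈ D) : C = D :=
  (hC.subset_of_mem hD hcC hcD).antisymm (hD.subset_of_mem hC hcD hcC)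

/-- A connected set together with a family of connected sets, each joined to it by an edge,
is connected. -/
theorem connected_induce_union_biUnion {ι : Type*} {s : Set V} {t : ι → Set V} {I : Set ι}
    (hs : (G.induce s).Connected) (ht : ∀ i ∈ I, (G.induce (t i)).Connected)
    (hadj : ∀ i ∈ I, ∃ a ∈ t i, ∃ b ∈ s, G.Adj a b) :
    (G.induce (s ∪ ⋃ i ∈ I, t i)).Connected := by
  obtain ⟨⟨x, hx⟩⟩ := hs.nonempty
  refine G.induce_connected_of_patches x (Or.inl hx) fun {z} hz => ?_
  rcases hz with hz | hz
  · exact ⟨s, Set.subset_union_left, hx, hz, hs.preconnected _ _⟩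
  · obtain ⟨i, hi, hzi⟩ := Set.mem_iUnion₂.1 hz
    obtain ⟨a, ha, b, hb, hab⟩ := hadj i hi
    have hst : (G.induce (s ∪ t i)).Connected :=
      SimpleGraph.connected_induce_union hs.preconnected (ht i hi).preconnected hb ha hab.symm
    exact ⟨s ∪ t i, Set.union_subset_union_right s (Set.subset_biUnion_of_mem hi),
      Or.inl hx, Or.inr hzi, hst.preconnected _ _⟩

end

/-- Invariant C1/C2: let `T` be a DFS tree of `G` rooted at `r`, let `p'` be the vertex set of
an ancestor–descendant path of `T`, and let `v 1, …, v k` be pairwise incomparable vertices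
whose subtrees `T(v i)` are disjoint from `p'`. Set `S = p' ∪ T(v 1) ∪ … ∪ T(v k)`. Then the
connected components of the subgraph of `G` induced on `S` are exactly: each `T(v i)` having
no `G`-edge to `p'` (type C1), and one component consisting of `p'` together with all the
`T(v i)` having a `G`-edge to `p'` (type C2). -/
theorem unvisited_components_C1_C2 {V : Type*} [Fintype V] (G T : SimpleGraph V) (r : V)
    (hDFS : IsDFSTree G T r) (x y : V) (hxy : IsAncestor T r x y)
    (p' : Set V) (hp' : p' = tpath T r x y)
    (k : ℕ) (v : Fin k → V)
    (hinc : ∀ i j : Fin k, i ≠ j → ¬ IsAncestor T r (v i) (v j))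
    (hdisj : ∀ i : Fin k, Disjoint (descendants T r (v i)) p')
    (S : Set V) (hS : S = p' ∪ ⋃ i : Fin k, descendants T r (v i)) :
    ∀ C : Set V, IsComponentOf G S C ↔
      ((∃ i : Fin k, (∀ a ∈ descendants T r (v i), ∀ b ∈ p', ¬ G.Adj a b) ∧
          C = descendants T r (v i)) ∨
       C = p' ∪ ⋃ i ∈ {i : Fin k | ∃ a ∈ descendants T r (v i), ∃ b ∈ p', G.Adj a b},
              descendants T r (v i)) := by
  subst hp' hS
  obtain ⟨hTG, hT, -⟩ := id hDFS
  set I := {i : Fin k | ∃ a ∈ descendants T r (v i), ∃ b ∈ tpath T r x y, G.Adj a b}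
  have hcross : ∀ i j : Fin k, i ≠ j → ∀ a ∈ descendants T r (v i),
      ∀ b ∈ descendants T r (v j), ¬ G.Adj a b := fun i j hij _ ha _ hb =>
    hDFS.not_adj_descendants (hinc i j hij) (hinc j i hij.symm) ha hb
  have hC1 : ∀ i : Fin k, i ∉ I → IsComponentOf G
      (tpath T r x y ∪ ⋃ i : Fin k, descendants T r (v i)) (descendants T r (v i)) := by
    intro i hi
    refine ⟨fun a ha => Or.inr (Set.mem_iUnion.2 ⟨i, ha⟩), ⟨v i, IsAncestor.refl_s6 T r _⟩,
      connected_induce_descendants hT hTG _, ?_⟩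
    rintro a ha b (hb | hb) hbi hab
    · exact hi ⟨a, ha, b, hb, hab⟩
    · obtain ⟨j, hj⟩ := Set.mem_iUnion.1 hb
      exact hcross i j (by rintro rfl; exact hbi hj) a ha b hj hab
  have hC2 : IsComponentOf G (tpath T r x y ∪ ⋃ i : Fin k, descendants T r (v i))
      (tpath T r x y ∪ ⋃ i ∈ I, descendants T r (v i)) := by
    refine ⟨Set.union_subset_union_right _
      (Set.iUnion₂_subset fun i _ => Set.subset_iUnion (fun i => descendants T r (v i)) i),
      ⟨x, Or.inl ⟨IsAncestor.refl_s6 T r x, hxy⟩⟩,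
      connected_induce_union_biUnion (connected_induce_tpath hT hTG hxy)
        (fun i _ => connected_induce_descendants hT hTG _) (fun i hi => hi), ?_⟩
    rintro a ha b (hb | hb) hbC hab
    · exact hbC (Or.inl hb)
    · obtain ⟨j, hj⟩ := Set.mem_iUnion.1 hb
      have hjI : j ∉ I := fun h => hbC (Or.inr (Set.mem_iUnion₂.2 ⟨j, h, hj⟩))
      rcases ha with ha | ha
      · exact hjI ⟨b, hj, a, ha, hab.symm⟩
      · obtain ⟨i, hi, hai⟩ := Set.mem_iUnion₂.1 ha
        exact hcross i j (by rintro rfl; exact hjI hi) a hai b hj hab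
  intro C
  constructor
  · intro hC
    obtain ⟨c, hc⟩ := hC.2.1
    rcases hC.1 hc with h | h
    · exact Or.inr (hC.eq_of_mem_s6 hC2 hc (Or.inl h))
    · obtain ⟨i, hi⟩ := Set.mem_iUnion.1 h
      by_cases hiI : i ∈ I
      · exact Or.inr (hC.eq_of_mem_s6 hC2 hc (Or.inr (Set.mem_iUnion₂.2 ⟨i, hiI, hi⟩)))
      · exact Or.inl ⟨i, fun a ha b hb hab => hiI ⟨a, ha, b, hb, hab⟩,
          hC.eq_of_mem_s6 (hC1 i hiI) hc hi⟩
  · rintro (⟨i, hi, rfl⟩ | rfl)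
    · exact hC1 i fun ⟨a, ha, b, hb, hab⟩ => hi a ha b hb hab
    · exact hC2
end
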